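/- Let W = m_1P_1+⋯+m_sP_s be a fat point scheme in P^2 (char K = 0), with fattenings W^{(1)} and W^{(2)}, and let t = max{r_{W^{(2)}}, r_{W^{(1)}}+1, r_W+2} where r denotes the regularity index of the Hilbert function. Then for all i ≥ t, the sequence of K-vector spaces 0 → (I_{W^{(1)}}/I_{W^{(2)}})_i → (I_W Ω^1_{S/K}/I_{W^{(1)}} Ω^1_{S/K})_i → (Ω^2_{S/K}/I_W Ω^2_{S/K})_i → (Ω^2_{R_W/K})_i → 0 is exact, where the maps are induced by exterior differentiation. -/

import Mathlib

open MvPolynomial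

/-- The homogeneous vanishing ideal of the `K`-rational point of `ℙ²` with homogeneous
coordinates `v`. -/
noncomputable def pointIdeal {K : Type*} [Field K] (v : Fin 3 → K) :
    Ideal (MvPolynomial (Fin 3) K) :=
  Ideal.span {F | (∃ d, F.IsHomogeneous d) ∧ MvPolynomial.eval v F = 0}

/-- The Hilbert function of `S/I` : the dimension of the degree-`i` homogeneous
component of the quotient. -/
noncomputable def quotHF {K : Type*} [Field K] (I : Ideal (MvPolynomial (Fin 3) K))
    (i : ℕ) : ℕ :=
  Module.finrank K
    (↥(homogeneousSubmodule (Fin 3) K i) ⧸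
      Submodule.comap (homogeneousSubmodule (Fin 3) K i).subtype (I.restrictScalars K))

/-- The regularity index of a fat point scheme `V` in `ℙ²`: the least `i` with
`HF_V(i) = deg V`. -/
noncomputable def regIndex {K : Type*} [Field K] (I : Ideal (MvPolynomial (Fin 3) K))
    (deg : ℕ) : ℕ :=
  sInf {i : ℕ | quotHF I i = deg}

/-- The ambient form of the map `β`, i.e. exterior differentiation
`Σ G_j dX_j ↦ Σ dG_j ∧ dX_j`, in coordinates w.r.t. the bases `dX₀, dX₁, dX₂` of
`Ω¹_{S/K}` and `dX₀∧dX₁, dX₀∧dX₂, dX₁∧dX₂` of `Ω²_{S/K}`. -/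
noncomputable def betaAmb {K : Type*} [Field K] (G : Fin 3 → MvPolynomial (Fin 3) K) :
    Fin 3 → MvPolynomial (Fin 3) K :=
  ![pderiv (0 : Fin 3) (G 1) - pderiv (1 : Fin 3) (G 0),
    pderiv (0 : Fin 3) (G 2) - pderiv (2 : Fin 3) (G 0),
    pderiv (1 : Fin 3) (G 2) - pderiv (2 : Fin 3) (G 1)]

/-- The ambient relation submodule `I_W Ω²_{S/K} + dI_W ∧ Ω¹_{S/K} ⊆ Ω²_{S/K} ≅ S³`. -/
noncomputable def omega2Rel {K : Type*} [Field K] (IW : Ideal (MvPolynomial (Fin 3) K)) :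
    Submodule (MvPolynomial (Fin 3) K) (Fin 3 → MvPolynomial (Fin 3) K) :=
  Submodule.pi Set.univ
      (fun _ => (IW : Submodule (MvPolynomial (Fin 3) K) (MvPolynomial (Fin 3) K))) ⊔
    Submodule.span (MvPolynomial (Fin 3) K)
      {x | ∃ F ∈ IW,
        x = ![-(pderiv (1 : Fin 3) F), -(pderiv (2 : Fin 3) F), 0] ∨
        x = ![pderiv (0 : Fin 3) F, 0, -(pderiv (2 : Fin 3) F)] ∨
        x = ![0, pderiv (0 : Fin 3) F, pderiv (1 : Fin 3) F]}

section Derivations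

variable {R A : Type*} [CommRing R] [CommRing A] [Algebra R A]

theorem Derivation.apply_mem_pow_of_mem_pow_succ (D : Derivation R A A) (p : Ideal A) (n : ℕ)
    {x : A} (hx : x ∈ p ^ (n + 1)) : D x ∈ p ^ n := by
  induction n generalizing x with
  | zero => simp
  | succ n ih =>
    rw [pow_succ] at hx
    refine Submodule.mul_induction_on hx (fun a ha b hb => ?_) (fun a b ha hb => ?_)
    · rw [D.leibniz, smul_eq_mul, smul_eq_mul]
      refine Ideal.add_mem _ (Ideal.mul_mem_right _ _ ha) ?_
      rw [pow_succ, mul_comm b]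
      exact Ideal.mul_mem_mul (ih ha) hb
    · rw [map_add]
      exact Ideal.add_mem _ ha hb

theorem Derivation.apply_mem_pow (D : Derivation R A A) {p : Ideal A}
    (hD : ∀ x ∈ p, D x ∈ p) (n : ℕ) {x : A} (hx : x ∈ p ^ n) : D x ∈ p ^ n := by
  induction n generalizing x with
  | zero => simp
  | succ n ih =>
    rw [pow_succ] at hx
    refine Submodule.mul_induction_on hx (fun a ha b hb => ?_) (fun a b ha hb => ?_)
    · rw [D.leibniz, smul_eq_mul, smul_eq_mul, pow_succ, mul_comm b]
      exact Ideal.add_mem _ (Ideal.mul_mem_mul ha (hD b hb)) (Ideal.mul_mem_mul (ih ha) hb)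
    · rw [map_add]
      exact Ideal.add_mem _ ha hb

/-- A derivation acting as the identity on `p / p ^ 2` acts as multiplication by `n`
on `p ^ n / p ^ (n + 1)`. -/
theorem Derivation.apply_sub_mem_pow_succ (D : Derivation R A A) {p : Ideal A}
    (hD : ∀ x ∈ p, D x - x ∈ p ^ 2) (hD' : ∀ x, D x ∈ p) (n : ℕ) {x : A} (hx : x ∈ p ^ n) :
    D x - (n : A) * x ∈ p ^ (n + 1) := by
  induction n generalizing x with
  | zero => simpa using hD' x
  | succ n ih =>
    rw [pow_succ] at hx
    refine Submodule.mul_induction_on hx (fun a ha b hb => ?_) (fun a b ha hb => ?_)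
    · have h : D (a * b) - ((n + 1 : ℕ) : A) * (a * b)
          = a * (D b - b) + (D a - (n : A) * a) * b := by
        rw [D.leibniz, smul_eq_mul, smul_eq_mul]
        push_cast
        ring
      rw [h]
      refine Ideal.add_mem _ ?_ ?_
      · rw [show n + 1 + 1 = n + 2 from rfl, pow_add]
        exact Ideal.mul_mem_mul ha (hD b hb)
      · rw [pow_succ]
        exact Ideal.mul_mem_mul (ih ha) hb
    · rw [map_add, mul_add, add_sub_add_comm]
      exact Ideal.add_mem _ ha hb

end Derivations

section Points

variable {K : Type*} [Field K]

/-- The linear form with coefficient vector `a`. -/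
noncomputable def linForm (a : Fin 3 → K) : MvPolynomial (Fin 3) K :=
  ∑ k, C (a k) * X k

/-- The linear forms `X_k - v_k ℓ_a`, which generate the ideal of the point `v`
when `ℓ_a(v) = 1`. -/
noncomputable def pointGen (v a : Fin 3 → K) (k : Fin 3) : MvPolynomial (Fin 3) K :=
  X k - C (v k) * linForm a

theorem isHomogeneous_linForm (a : Fin 3 → K) : (linForm a).IsHomogeneous 1 :=
  IsHomogeneous.sum _ _ _ fun k _ => isHomogeneous_C_mul_X _ k

theorem isHomogeneous_pointGen (v a : Fin 3 → K) (k : Fin 3) :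
    (pointGen v a k).IsHomogeneous 1 :=
  (isHomogeneous_X K k).sub ((isHomogeneous_linForm a).C_mul _)

theorem eval_linForm (a v : Fin 3 → K) : eval v (linForm a) = a ⬝ᵥ v := by
  simp [linForm, dotProduct]

theorem exists_dotProduct_eq_one {v : Fin 3 → K} (hv : v ≠ 0) : ∃ a : Fin 3 → K, a ⬝ᵥ v = 1 := by
  obtain ⟨k, hk⟩ := Function.ne_iff.mp hv
  exact ⟨Pi.single k (v k)⁻¹, by simpa using inv_mul_cancel₀ hk⟩

theorem mem_pointIdeal_of_isHomogeneous {v : Fin 3 → K} {F : MvPolynomial (Fin 3) K} {d : ℕ}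
    (hF : F.IsHomogeneous d) (h : eval v F = 0) : F ∈ pointIdeal v :=
  Ideal.subset_span ⟨⟨d, hF⟩, h⟩

theorem eval_eq_zero_of_mem_pointIdeal {v : Fin 3 → K} {F : MvPolynomial (Fin 3) K}
    (h : F ∈ pointIdeal v) : eval v F = 0 := by
  have : pointIdeal v ≤ RingHom.ker (eval v) := Ideal.span_le.mpr fun F hF => hF.2
  exact this h

theorem MvPolynomial.IsHomogeneous.aeval_C_mul_eq {F : MvPolynomial (Fin 3) K} {d : ℕ}
    (hF : F.IsHomogeneous d) (v : Fin 3 → K) (L : MvPolynomial (Fin 3) K) :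
    MvPolynomial.aeval (fun k => C (v k) * L) F = C (eval v F) * L ^ d := by
  rw [aeval_def, eval₂_eq', eval_eq', map_sum, Finset.sum_mul]
  refine Finset.sum_congr rfl fun e he => ?_
  have hd : ∑ k, e k = d := by
    rw [← hF (mem_support_iff.mp he), Finsupp.weight_apply, Finsupp.sum_fintype] <;> simp
  simp only [mul_pow, Finset.prod_mul_distrib, Finset.prod_pow_eq_pow_sum, hd, map_mul, map_prod,
    map_pow, MvPolynomial.algebraMap_eq]
  ring

theorem aeval_sub_aeval_mem {σ B : Type*} [CommRing B] [Algebra K B] (J : Ideal B) (f g : σ → B)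
    (h : ∀ k, f k - g k ∈ J) (F : MvPolynomial σ K) : aeval f F - aeval g F ∈ J := by
  rw [← Ideal.Quotient.eq]
  have : (Ideal.Quotient.mkₐ K J).comp (aeval f) = (Ideal.Quotient.mkₐ K J).comp (aeval g) := by
    ext k
    simpa using Ideal.Quotient.eq.mpr (h k)
  exact DFunLike.congr_fun this F

theorem pointGen_mem_pointIdeal {v a : Fin 3 → K} (ha : a ⬝ᵥ v = 1) (k : Fin 3) :
    pointGen v a k ∈ pointIdeal v :=
  mem_pointIdeal_of_isHomogeneous (isHomogeneous_pointGen v a k)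
    (by simp [pointGen, eval_linForm, ha])

theorem pointIdeal_eq_span {v a : Fin 3 → K} (ha : a ⬝ᵥ v = 1) :
    pointIdeal v = Ideal.span (Set.range (pointGen v a)) := by
  apply le_antisymm
  · refine Ideal.span_le.mpr ?_
    rintro F ⟨⟨d, hd⟩, hF⟩
    have h := aeval_sub_aeval_mem (Ideal.span (Set.range (pointGen v a))) X
      (fun k => C (v k) * linForm a) (fun k => Ideal.subset_span ⟨k, rfl⟩) F
    rwa [hd.aeval_C_mul_eq, hF, map_zero, zero_mul, sub_zero, aeval_X_left_apply] at h
  · refine Ideal.span_le.mpr ?_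
    rintro _ ⟨k, rfl⟩
    exact pointGen_mem_pointIdeal ha k

theorem pderiv_pointGen (v a : Fin 3 → K) (k l : Fin 3) :
    pderiv l (pointGen v a k) = (if k = l then 1 else 0) - C (v k * a l) := by
  simp [pointGen, linForm, pderiv_X, Pi.single_apply]

theorem MvPolynomial.mkDerivation_eq_sum (f : Fin 3 → MvPolynomial (Fin 3) K)
    (F : MvPolynomial (Fin 3) K) : mkDerivation K f F = ∑ k, f k * pderiv k F := by
  have h : mkDerivation K f = ∑ k, f k • pderiv k := by
    refine derivation_ext fun k => ?_
    fin_cases k <;> simp [Fin.sum_univ_three, pderiv_X]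
  simp [h, Fin.sum_univ_three]

theorem eval_sum_mul_pderiv_eq_zero {v : Fin 3 → K} {F : MvPolynomial (Fin 3) K} {d : ℕ}
    (hd : F.IsHomogeneous d) (hF : eval v F = 0) : eval v (∑ k, C (v k) * pderiv k F) = 0 := by
  simpa [hF] using congrArg (eval v) hd.sum_X_mul_pderiv

theorem isHomogeneous_sum_C_mul_pderiv (v : Fin 3 → K) {F : MvPolynomial (Fin 3) K} {d : ℕ}
    (hd : F.IsHomogeneous d) : (∑ k, C (v k) * pderiv k F).IsHomogeneous (d - 1) :=
  IsHomogeneous.sum _ _ _ fun _ _ => hd.pderiv.C_mul _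

/-- The directional derivative along `v` preserves the powers of the ideal of the point `v`. -/
theorem sum_C_mul_pderiv_mem_pow {v : Fin 3 → K} (n : ℕ) {F : MvPolynomial (Fin 3) K}
    (hF : F ∈ pointIdeal v ^ n) : ∑ k, C (v k) * pderiv k F ∈ pointIdeal v ^ n := by
  rw [← mkDerivation_eq_sum]
  refine Derivation.apply_mem_pow _ (fun x hx => ?_) n hF
  refine Submodule.span_induction ?_ ?_ ?_ ?_ hx
  · rintro F ⟨⟨d, hd⟩, hF⟩
    rw [mkDerivation_eq_sum]
    exact mem_pointIdeal_of_isHomogeneous (isHomogeneous_sum_C_mul_pderiv v hd)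
      (eval_sum_mul_pderiv_eq_zero hd hF)
  · simp
  · intro x y _ _ hx hy
    rw [map_add]
    exact Ideal.add_mem _ hx hy
  · intro a x hxs hx
    rw [smul_eq_mul, Derivation.leibniz, smul_eq_mul, smul_eq_mul]
    exact Ideal.add_mem _ (Ideal.mul_mem_left _ _ hx) (Ideal.mul_mem_right _ _ hxs)

theorem sum_pointGen_mul_C {v a : Fin 3 → K} (ha : a ⬝ᵥ v = 1) :
    ∑ l, pointGen v a l * C (a l) = 0 := by
  have h : (C (a 0) * C (v 0) + C (a 1) * C (v 1) + C (a 2) * C (v 2) :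
      MvPolynomial (Fin 3) K) = 1 := by
    rw [← C_1, ← ha, dotProduct, Fin.sum_univ_three]
    simp only [map_add, map_mul]
  have hL : linForm a = C (a 0) * X 0 + C (a 1) * X 1 + C (a 2) * X 2 :=
    Fin.sum_univ_three _
  simp only [pointGen, Fin.sum_univ_three]
  linear_combination (-linForm a) * h - hL

theorem sum_pointGen_mul_pderiv_pointGen {v a : Fin 3 → K} (ha : a ⬝ᵥ v = 1) (k : Fin 3) :
    ∑ l, pointGen v a l * pderiv l (pointGen v a k) = pointGen v a k := by
  have h : ∑ l, pointGen v a l * C (v k * a l) = 0 := by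
    rw [← mul_zero (C (v k)), ← sum_pointGen_mul_C ha, Finset.mul_sum]
    exact Finset.sum_congr rfl fun l _ => by rw [map_mul]; ring
  simp only [pderiv_pointGen, mul_sub, Finset.sum_sub_distrib, h, sub_zero]
  simp

/-- A local Euler identity: `∑ (X_k - v_k ℓ_a) ∂_k` acts as multiplication by `n`
on `p ^ n / p ^ (n + 1)`, where `p` is the ideal of the point `v`. -/
theorem sum_pointGen_mul_pderiv_sub_mem {v a : Fin 3 → K} (ha : a ⬝ᵥ v = 1) (n : ℕ)
    {F : MvPolynomial (Fin 3) K} (hF : F ∈ pointIdeal v ^ n) :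
    ∑ k, pointGen v a k * pderiv k F - (n : MvPolynomial (Fin 3) K) * F
      ∈ pointIdeal v ^ (n + 1) := by
  rw [← mkDerivation_eq_sum]
  have hD' : ∀ x, mkDerivation K (pointGen v a) x ∈ pointIdeal v := fun x => by
    rw [mkDerivation_eq_sum]
    exact Ideal.sum_mem _ fun k _ => Ideal.mul_mem_right _ _ (pointGen_mem_pointIdeal ha k)
  refine Derivation.apply_sub_mem_pow_succ _ (fun x hx => ?_) hD' n hF
  rw [pointIdeal_eq_span ha] at hx
  refine Submodule.span_induction ?_ ?_ ?_ ?_ hx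
  · rintro _ ⟨k, rfl⟩
    rw [mkDerivation_eq_sum, sum_pointGen_mul_pderiv_pointGen ha, sub_self]
    exact zero_mem _
  · simp
  · intro x y _ _ hx hy
    rw [map_add, add_sub_add_comm]
    exact Ideal.add_mem _ hx hy
  · intro b x hxs hx
    replace hxs : x ∈ pointIdeal v := by rw [pointIdeal_eq_span ha]; exact hxs
    rw [smul_eq_mul, Derivation.leibniz, smul_eq_mul, smul_eq_mul, add_sub_right_comm, ← mul_sub]
    refine Ideal.add_mem _ (Ideal.mul_mem_left _ _ hx) ?_
    rw [pow_two]
    exact Ideal.mul_mem_mul hxs (hD' b)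

theorem pderiv_mem_pow {v : Fin 3 → K} {n : ℕ} {F : MvPolynomial (Fin 3) K}
    (hF : F ∈ pointIdeal v ^ (n + 1)) (k : Fin 3) : pderiv k F ∈ pointIdeal v ^ n :=
  (pderiv k).apply_mem_pow_of_mem_pow_succ _ n hF

theorem mem_of_natCast_mul_mem [CharZero K] {I : Ideal (MvPolynomial (Fin 3) K)} {n : ℕ}
    (hn : n ≠ 0) {F : MvPolynomial (Fin 3) K} (h : (n : MvPolynomial (Fin 3) K) * F ∈ I) :
    F ∈ I := by
  have h1 : C (n : K)⁻¹ * ((n : MvPolynomial (Fin 3) K) * F) = F := by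
    rw [← map_natCast (C : K →+* MvPolynomial (Fin 3) K), ← mul_assoc, ← map_mul,
      inv_mul_cancel₀ (Nat.cast_ne_zero.mpr hn), map_one, one_mul]
  exact h1 ▸ Ideal.mul_mem_left I _ h

/-- A form in `p ^ n`, `n ≥ 1`, whose partial derivatives all lie in `p ^ n` is in
`p ^ (n + 1)`. -/
theorem mem_pow_succ_of_pderiv_mem [CharZero K] {v : Fin 3 → K} (hv : v ≠ 0) {n : ℕ}
    (hn : n ≠ 0) {F : MvPolynomial (Fin 3) K} (hF : F ∈ pointIdeal v ^ n)
    (h : ∀ k, pderiv k F ∈ pointIdeal v ^ n) : F ∈ pointIdeal v ^ (n + 1) := by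
  obtain ⟨a, ha⟩ := exists_dotProduct_eq_one hv
  refine mem_of_natCast_mul_mem hn ?_
  have h1 := sum_pointGen_mul_pderiv_sub_mem ha n hF
  have h2 : ∑ k, pointGen v a k * pderiv k F ∈ pointIdeal v ^ (n + 1) := by
    rw [pow_succ']
    exact Ideal.sum_mem _ fun k _ => Ideal.mul_mem_mul (pointGen_mem_pointIdeal ha k) (h k)
  simpa using Ideal.sub_mem _ h2 h1

/-- A local Poincaré lemma: a `1`-form with coefficients in `p ^ m` that is closed modulo `p ^ m`
is exact modulo `p ^ (m + 1)`. -/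
theorem exists_primitive_mod_pow [CharZero K] {v : Fin 3 → K} (hv : v ≠ 0) {m d : ℕ}
    (hm : m ≠ 0) {G : Fin 3 → MvPolynomial (Fin 3) K} (hG : ∀ k, G k ∈ pointIdeal v ^ m)
    (hd : ∀ k, (G k).IsHomogeneous d)
    (hclosed : ∀ k l, pderiv l (G k) - pderiv k (G l) ∈ pointIdeal v ^ m) :
    ∃ F ∈ pointIdeal v ^ (m + 1), F.IsHomogeneous (d + 1) ∧
      ∀ l, G l - pderiv l F ∈ pointIdeal v ^ (m + 1) := by
  obtain ⟨a, ha⟩ := exists_dotProduct_eq_one hv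
  set p := pointIdeal v with hp
  set c : MvPolynomial (Fin 3) K := C ((m + 1 : ℕ) : K)⁻¹ with hc
  have hc1 : c * ((m : MvPolynomial (Fin 3) K) + 1) = 1 := by
    have : ((m : MvPolynomial (Fin 3) K) + 1) = C ((m + 1 : ℕ) : K) := by simp
    rw [this, hc, ← map_mul, inv_mul_cancel₀ (Nat.cast_ne_zero.mpr m.succ_ne_zero), map_one]
  have hGv : ∑ k, C (v k) * G k ∈ p ^ (m + 1) := by
    refine mem_pow_succ_of_pderiv_mem hv hm
      (Ideal.sum_mem _ fun k _ => Ideal.mul_mem_left _ _ (hG k)) fun l => ?_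
    have h1 := Ideal.add_mem _ (sum_C_mul_pderiv_mem_pow m (hG l))
      (Ideal.sum_mem _ fun k (_ : k ∈ Finset.univ) =>
        Ideal.mul_mem_left _ (C (v k)) (hclosed k l))
    rw [← Finset.sum_add_distrib] at h1
    convert h1 using 1
    rw [map_sum]
    refine Finset.sum_congr rfl fun k _ => ?_
    rw [pderiv_C_mul]
    ring
  refine ⟨c * ∑ k, pointGen v a k * G k, Ideal.mul_mem_left _ _ ?_, ?_, fun l => ?_⟩
  · rw [pow_succ']
    exact Ideal.sum_mem _ fun k _ => Ideal.mul_mem_mul (pointGen_mem_pointIdeal ha k) (hG k)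
  · rw [add_comm]
    exact (IsHomogeneous.sum _ _ _ fun k _ => (isHomogeneous_pointGen v a k).mul (hd k)).C_mul _
  · have h1 := sum_pointGen_mul_pderiv_sub_mem ha m (hG l)
    have h2 : ∑ k, pointGen v a k * (pderiv l (G k) - pderiv k (G l)) ∈ p ^ (m + 1) := by
      rw [pow_succ']
      exact Ideal.sum_mem _ fun k _ =>
        Ideal.mul_mem_mul (pointGen_mem_pointIdeal ha k) (hclosed k l)
    have h3 : pderiv l (c * ∑ k, pointGen v a k * G k)
        = c * (G l - C (a l) * ∑ k, C (v k) * G k + ∑ k, pointGen v a k * pderiv l (G k)) := by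
      rw [hc, pderiv_C_mul, map_sum]
      congr 1
      have : ∀ k, pderiv l (pointGen v a k * G k) = (if k = l then G k else 0)
          - C (a l) * (C (v k) * G k) + pointGen v a k * pderiv l (G k) := fun k => by
        rw [pderiv_mul, pderiv_pointGen, map_mul]
        split_ifs <;> ring
      simp only [this, Finset.sum_add_distrib, Finset.sum_sub_distrib, Finset.mul_sum]
      simp
    have h4 : G l - pderiv l (c * ∑ k, pointGen v a k * G k)
        = c * (C (a l) * ∑ k, C (v k) * G k
          - (∑ k, pointGen v a k * pderiv k (G l) - (m : MvPolynomial (Fin 3) K) * G l)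
          - ∑ k, pointGen v a k * (pderiv l (G k) - pderiv k (G l))) := by
      rw [h3]
      simp only [mul_sub (pointGen v a _), Finset.sum_sub_distrib]
      linear_combination (-(G l)) * hc1
    rw [h4]
    exact Ideal.mul_mem_left _ _
      (Ideal.sub_mem _ (Ideal.sub_mem _ (Ideal.mul_mem_left _ _ hGv) h1) h2)

theorem mem_pow_of_mul_mem_pow [CharZero K] {v : Fin 3 → K} (hv : v ≠ 0)
    {U : MvPolynomial (Fin 3) K} (hU : eval v U ≠ 0) (n : ℕ) {d : ℕ}
    {F : MvPolynomial (Fin 3) K} (hF : F.IsHomogeneous d) (h : U * F ∈ pointIdeal v ^ n) :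
    F ∈ pointIdeal v ^ n := by
  induction n generalizing F d with
  | zero => simp
  | succ n ih =>
    have hFn : F ∈ pointIdeal v ^ n := ih hF (Ideal.pow_le_pow_right n.le_succ h)
    rcases eq_or_ne n 0 with rfl | hn
    · rw [zero_add, pow_one] at h ⊢
      have h0 := eval_eq_zero_of_mem_pointIdeal h
      rw [map_mul] at h0
      exact mem_pointIdeal_of_isHomogeneous hF ((mul_eq_zero.mp h0).resolve_left hU)
    · refine mem_pow_succ_of_pderiv_mem hv hn hFn fun k => ih hF.pderiv ?_
      have h1 := pderiv_mem_pow h k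
      rw [pderiv_mul] at h1
      simpa using Ideal.sub_mem _ h1 (Ideal.mul_mem_left _ (pderiv k U) hFn)

end Points

section HilbertFunction

variable {K : Type*} [Field K]

theorem finrank_homogeneousSubmodule (d : ℕ) :
    Module.finrank K (homogeneousSubmodule (Fin 3) K d) = (d + 2).choose 2 := by
  rw [homogeneousSubmodule_eq_finsupp_supported]
  have hs : {e : Fin 3 →₀ ℕ | e.degree = d} =
      ((Finset.univ : Finset (Fin 3)).finsuppAntidiag d : Set (Fin 3 →₀ ℕ)) := by
    ext e
    simp [Finsupp.degree_eq_sum]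
  rw [hs, (AddMonoidAlgebra.supportedEquivFinsupp (R := K) (S := K)
    ((Finset.univ : Finset (Fin 3)).finsuppAntidiag d : Set (Fin 3 →₀ ℕ))).finrank_eq,
    Module.finrank_finsupp_self, ← Set.toFinset_card, Finset.toFinset_coe,
    Finset.card_finsuppAntidiag_nat_eq_choose, Finset.card_univ, Fintype.card_fin,
    show 3 + d - 1 = d + 2 by omega]
  exact Nat.choose_symm_add

instance (d : ℕ) : Module.Finite K (homogeneousSubmodule (Fin 3) K d) :=
  Module.Finite.iff_fg.mpr (homogeneousSubmodule_fg (Fin 3) K d)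

/-- The degree-`d` part of an ideal, as a subspace of the space of forms of degree `d`. -/
noncomputable abbrev idealPart (I : Ideal (MvPolynomial (Fin 3) K)) (d : ℕ) :
    Submodule K (homogeneousSubmodule (Fin 3) K d) :=
  Submodule.comap (homogeneousSubmodule (Fin 3) K d).subtype (I.restrictScalars K)

/-- Multiplication by a form of degree `u`, on forms of degree `d`. -/
noncomputable def mulForm {U : MvPolynomial (Fin 3) K} {u : ℕ} (hU : U.IsHomogeneous u) (d : ℕ) :
    homogeneousSubmodule (Fin 3) K d →ₗ[K] homogeneousSubmodule (Fin 3) K (u + d) :=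
  (LinearMap.mulLeft K U).restrict fun _ hF => hU.mul hF

theorem homogeneousComponent_mul_of_isHomogeneous {U : MvPolynomial (Fin 3) K} {u : ℕ}
    (hU : U.IsHomogeneous u) (G : MvPolynomial (Fin 3) K) (d : ℕ) :
    homogeneousComponent (u + d) (U * G) = U * homogeneousComponent d G := by
  have h : ∀ j, homogeneousComponent (u + d) (U * homogeneousComponent j G)
      = if d = j then U * homogeneousComponent j G else 0 := fun j => by
    rw [homogeneousComponent_of_mem (hU.mul (homogeneousComponent_isHomogeneous j G))]
    simp only [add_right_inj]
  conv_lhs => rw [← sum_homogeneousComponent G, Finset.mul_sum, map_sum]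
  simp only [h, Finset.sum_ite_eq, Finset.mem_range]
  split_ifs with hd
  · rfl
  · rw [homogeneousComponent_eq_zero d G (by omega), mul_zero]

theorem quotHF_le_of_mul_mem_iff {I J : Ideal (MvPolynomial (Fin 3) K)}
    {U : MvPolynomial (Fin 3) K} {u d : ℕ} (hU : U.IsHomogeneous u)
    (h : ∀ F : MvPolynomial (Fin 3) K, F.IsHomogeneous d → (U * F ∈ J ↔ F ∈ I)) :
    quotHF I d ≤ quotHF J (u + d) := by
  have hcomap : idealPart I d = (idealPart J (u + d)).comap (mulForm hU d) := by
    ext F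
    exact (h F F.2).symm
  refine LinearMap.finrank_le_finrank_of_injective
    (f := Submodule.mapQ (idealPart I d) (idealPart J (u + d)) (mulForm hU d) hcomap.le) ?_
  rw [← LinearMap.ker_eq_bot, Submodule.ker_mapQ, ← hcomap]
  exact Submodule.mkQ_map_self _

theorem quotHF_le_of_forall_exists_sub_mul_mem {I J : Ideal (MvPolynomial (Fin 3) K)} (hIJ : I ≤ J)
    {U : MvPolynomial (Fin 3) K} {u d : ℕ} (hU : U.IsHomogeneous u)
    (h : ∀ F : MvPolynomial (Fin 3) K, F.IsHomogeneous (u + d) →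
      ∃ G : MvPolynomial (Fin 3) K, G.IsHomogeneous d ∧ F - U * G ∈ J) :
    quotHF J (u + d) ≤ quotHF I d := by
  have hle : idealPart I d ≤ (idealPart J (u + d)).comap (mulForm hU d) :=
    fun F hF => J.mul_mem_left U (hIJ hF)
  refine LinearMap.finrank_le_finrank_of_surjective
    (f := Submodule.mapQ (idealPart I d) (idealPart J (u + d)) (mulForm hU d) hle) ?_
  intro x
  obtain ⟨F, rfl⟩ := Submodule.mkQ_surjective _ x
  obtain ⟨G, hG, hFG⟩ := h F F.2
  refine ⟨Submodule.mkQ _ ⟨G, hG⟩, Eq.symm ?_⟩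
  exact (Submodule.Quotient.eq (idealPart J (u + d))).mpr hFG

theorem MvPolynomial.IsHomogeneous.eq_zero_of_mem_pointIdeal_pow {v : Fin 3 → K} (hv : v ≠ 0)
    {n d : ℕ} (hd : d < n) {F : MvPolynomial (Fin 3) K} (hF : F.IsHomogeneous d)
    (h : F ∈ pointIdeal v ^ n) : F = 0 := by
  obtain ⟨a, ha⟩ := exists_dotProduct_eq_one hv
  have hle : pointIdeal v ≤ idealOfVars (Fin 3) K := by
    rw [pointIdeal_eq_span ha, Ideal.span_le]
    rintro _ ⟨k, rfl⟩
    have := (mem_pow_idealOfVars_iff 1 (pointGen v a k)).mpr fun x hx => by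
      by_contra hlt
      exact mem_support_iff.mp hx
        ((isHomogeneous_pointGen v a k).coeff_eq_zero (by omega))
    rwa [pow_one] at this
  have h1 := (mem_pow_idealOfVars_iff' n F).mp (Ideal.pow_right_mono hle n h)
  ext x
  rw [coeff_zero]
  by_cases hx : x.degree = d
  · exact h1 x (hx ▸ hd)
  · exact hF.coeff_eq_zero hx

theorem quotHF_pointIdeal_pow_self {v : Fin 3 → K} (hv : v ≠ 0) (r : ℕ) :
    quotHF (pointIdeal v ^ (r + 1)) r = (r + 2).choose 2 := by
  have hbot : idealPart (pointIdeal v ^ (r + 1)) r = ⊥ :=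
    (Submodule.eq_bot_iff _).mpr fun F hF =>
      Subtype.ext (F.2.eq_zero_of_mem_pointIdeal_pow hv r.lt_succ_self hF)
  rw [← finrank_homogeneousSubmodule (K := K) r]
  exact (Submodule.quotEquivOfEqBot _ hbot).finrank_eq

theorem quotHF_pointIdeal_pow_mono [CharZero K] {v : Fin 3 → K} (hv : v ≠ 0) (n : ℕ) :
    Monotone (quotHF (pointIdeal v ^ n)) := by
  obtain ⟨a, ha⟩ := exists_dotProduct_eq_one hv
  refine monotone_nat_of_le_succ fun d => ?_
  rw [add_comm]
  refine quotHF_le_of_mul_mem_iff (isHomogeneous_linForm a) fun F hF =>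
    ⟨fun h => mem_pow_of_mul_mem_pow hv ?_ n hF h, fun h => Ideal.mul_mem_left _ _ h⟩
  rw [eval_linForm, ha]
  exact one_ne_zero

theorem quotHF_pointIdeal_pow_succ_le {v : Fin 3 → K} (hv : v ≠ 0) {n d : ℕ} (hd : n ≤ d + 1) :
    quotHF (pointIdeal v ^ n) (d + 1) ≤ quotHF (pointIdeal v ^ n) d := by
  obtain ⟨a, ha⟩ := exists_dotProduct_eq_one hv
  rw [add_comm]
  refine quotHF_le_of_forall_exists_sub_mul_mem le_rfl (isHomogeneous_linForm a) fun F hF => ?_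
  have h1 : F - aeval (pointGen v a) F ∈ Ideal.span {linForm a} := by
    have := aeval_sub_aeval_mem (Ideal.span {linForm a}) X (pointGen v a) (fun k => by
      rw [pointGen, sub_sub_cancel]
      exact Ideal.mul_mem_left _ _ (Ideal.mem_span_singleton_self _)) F
    rwa [aeval_X_left_apply] at this
  have h2 : aeval (pointGen v a) F ∈ pointIdeal v ^ n := by
    refine Ideal.pow_le_pow_right hd ?_
    rw [pointIdeal_eq_span ha, Ideal.mem_span_pow_iff_exists_isHomogeneous]
    exact ⟨map C F, add_comm d 1 ▸ hF.map C, by rw [eval_map]; rfl⟩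
  obtain ⟨G, hG⟩ := Ideal.mem_span_singleton'.mp h1
  refine ⟨homogeneousComponent d G, homogeneousComponent_isHomogeneous _ _, ?_⟩
  have h3 : linForm a * homogeneousComponent d G = F - aeval (pointGen v a) F := by
    have h4 : (F - aeval (pointGen v a) F).IsHomogeneous (1 + d) := by
      refine hF.sub ?_
      rw [← one_mul (1 + d)]
      exact hF.aeval _ (isHomogeneous_pointGen v a)
    rw [← homogeneousComponent_mul_of_isHomogeneous (isHomogeneous_linForm a), mul_comm, hG]
    exact homogeneousComponent_eq_self h4
  rw [h3, sub_sub_cancel]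
  exact h2

theorem quotHF_pointIdeal_pow_eq [CharZero K] {v : Fin 3 → K} (hv : v ≠ 0) {r d : ℕ} (hd : r ≤ d) :
    quotHF (pointIdeal v ^ (r + 1)) d = (r + 2).choose 2 := by
  refine le_antisymm ?_ ?_
  · induction d, hd using Nat.le_induction with
    | base => exact (quotHF_pointIdeal_pow_self hv r).le
    | succ d hd ih => exact (quotHF_pointIdeal_pow_succ_le hv (Nat.succ_le_succ hd)).trans ih
  · exact quotHF_pointIdeal_pow_self hv r ▸ quotHF_pointIdeal_pow_mono hv _ hd

theorem quotHF_pointIdeal_pow_le [CharZero K] {v : Fin 3 → K} (hv : v ≠ 0) (r d : ℕ) :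
    quotHF (pointIdeal v ^ (r + 1)) d ≤ (r + 2).choose 2 :=
  (quotHF_pointIdeal_pow_mono hv _ (le_max_left d r)).trans
    (quotHF_pointIdeal_pow_eq hv (le_max_right d r)).le

end HilbertFunction

section FatPoints

variable {K : Type*} [Field K]

section QuotientInf

variable {V : Type*} [AddCommGroup V] [Module K V] {ι : Type*}

theorem exists_injective_quot_iInf (p : ι → Submodule K V) :
    ∃ f : (V ⧸ ⨅ j, p j) →ₗ[K] ∀ j, V ⧸ p j,
      Function.Injective f ∧ ∀ x j, f (Submodule.Quotient.mk x) j = Submodule.Quotient.mk x := by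
  have hker : ⨅ j, p j = LinearMap.ker (LinearMap.pi fun j => (p j).mkQ) := by
    simp only [LinearMap.ker_pi, Submodule.ker_mkQ]
  refine ⟨Submodule.liftQ _ _ hker.le, ?_, fun x j => rfl⟩
  rw [← LinearMap.ker_eq_bot]
  exact Submodule.ker_liftQ_eq_bot _ _ _ hker.ge

variable [FiniteDimensional K V] [Fintype ι]

theorem finrank_pi_quot (p : ι → Submodule K V) :
    Module.finrank K (∀ j, V ⧸ p j) = ∑ j, Module.finrank K (V ⧸ p j) :=
  Module.finrank_pi_fintype K

theorem finrank_quot_iInf_le (p : ι → Submodule K V) :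
    Module.finrank K (V ⧸ ⨅ j, p j) ≤ ∑ j, Module.finrank K (V ⧸ p j) := by
  obtain ⟨f, hf, -⟩ := exists_injective_quot_iInf p
  rw [← finrank_pi_quot]
  exact LinearMap.finrank_le_finrank_of_injective hf

theorem exists_forall_sub_mem_of_sum_finrank_le {p : ι → Submodule K V}
    (h : ∑ j, Module.finrank K (V ⧸ p j) ≤ Module.finrank K (V ⧸ ⨅ j, p j)) (x : ι → V) :
    ∃ y, ∀ j, y - x j ∈ p j := by
  obtain ⟨f, hf, hfj⟩ := exists_injective_quot_iInf p
  have hfin : Module.finrank K (V ⧸ ⨅ j, p j) = Module.finrank K (∀ j, V ⧸ p j) := by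
    rw [finrank_pi_quot]
    exact (finrank_quot_iInf_le p).antisymm h
  obtain ⟨z, hz⟩ := (LinearMap.injective_iff_surjective_of_finrank_eq_finrank hfin).mp hf
    fun j => Submodule.Quotient.mk (x j)
  obtain ⟨y, rfl⟩ := Submodule.Quotient.mk_surjective _ z
  exact ⟨y, fun j => (Submodule.Quotient.eq (p j)).mp ((hfj y j).symm.trans (congrFun hz j))⟩

end QuotientInf

theorem idealPart_iInf {s : ℕ} (J : Fin s → Ideal (MvPolynomial (Fin 3) K)) (i : ℕ) :
    idealPart (⨅ j, J j) i = ⨅ j, idealPart (J j) i := by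
  ext F
  rw [Submodule.mem_iInf]
  exact Submodule.mem_iInf _

theorem quotHF_iInf_le {s : ℕ} (J : Fin s → Ideal (MvPolynomial (Fin 3) K)) (i : ℕ) :
    quotHF (⨅ j, J j) i ≤ ∑ j, quotHF (J j) i := by
  have h := finrank_quot_iInf_le fun j => idealPart (J j) i
  rwa [← idealPart_iInf] at h

/-- If the Hilbert function of an intersection is the sum of the Hilbert functions, forms can be
prescribed modulo each of the ideals simultaneously. -/
theorem exists_form_of_sum_quotHF_le {s : ℕ} {J : Fin s → Ideal (MvPolynomial (Fin 3) K)} {i : ℕ}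
    (h : ∑ j, quotHF (J j) i ≤ quotHF (⨅ j, J j) i) (F : Fin s → MvPolynomial (Fin 3) K)
    (hF : ∀ j, (F j).IsHomogeneous i) :
    ∃ G : MvPolynomial (Fin 3) K, G.IsHomogeneous i ∧ ∀ j, G - F j ∈ J j := by
  obtain ⟨G, hG⟩ := exists_forall_sub_mem_of_sum_finrank_le (p := fun j => idealPart (J j) i)
    (by rw [← idealPart_iInf]; exact h) fun j => ⟨F j, hF j⟩
  exact ⟨G, G.2, hG⟩

theorem exists_dotProduct_forall_ne_zero [CharZero K] {s : ℕ} {v : Fin s → Fin 3 → K}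
    (hv : ∀ j, v j ≠ 0) : ∃ a : Fin 3 → K, ∀ j, a ⬝ᵥ v j ≠ 0 := by
  obtain ⟨f, hf⟩ := Module.exists_dual_forall_apply_ne_zero (K := K) v hv
  obtain ⟨a, rfl⟩ := (dotProductEquiv K (Fin 3)).surjective f
  exact ⟨a, hf⟩

theorem exists_dotProduct_ne_zero_eq_zero {v w : Fin 3 → K} (h : ∀ c : K, v ≠ c • w) :
    ∃ a : Fin 3 → K, a ⬝ᵥ v ≠ 0 ∧ a ⬝ᵥ w = 0 := by
  have hvw : v ∉ K ∙ w := fun hmem => by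
    obtain ⟨c, hc⟩ := Submodule.mem_span_singleton.mp hmem
    exact h c hc.symm
  obtain ⟨f, hf, hle⟩ := Submodule.exists_le_ker_of_notMem hvw
  obtain ⟨a, rfl⟩ := (dotProductEquiv K (Fin 3)).surjective f
  exact ⟨a, hf, hle (Submodule.mem_span_singleton_self w)⟩

/-- Forms of a common degree separating finitely many distinct points to prescribed orders. -/
theorem exists_separating_forms {s : ℕ} {v : Fin s → Fin 3 → K} (hv : ∀ j, v j ≠ 0)
    (hdist : ∀ i j, i ≠ j → ∀ c : K, v i ≠ c • v j) (n : Fin s → ℕ) :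
    ∃ U : Fin s → MvPolynomial (Fin 3) K, ∀ j, (U j).IsHomogeneous (∑ k, n k) ∧
      eval (v j) (U j) ≠ 0 ∧ ∀ k, k ≠ j → U j ∈ pointIdeal (v k) ^ n k := by
  have h : ∀ j k, ∃ a : Fin 3 → K, a ⬝ᵥ v j ≠ 0 ∧ (k ≠ j → a ⬝ᵥ v k = 0) := fun j k => by
    rcases eq_or_ne k j with rfl | hkj
    · obtain ⟨a, ha⟩ := exists_dotProduct_eq_one (hv k)
      exact ⟨a, ha ▸ one_ne_zero, fun h => absurd rfl h⟩
    · obtain ⟨a, ha, ha'⟩ := exists_dotProduct_ne_zero_eq_zero (hdist j k hkj.symm)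
      exact ⟨a, ha, fun _ => ha'⟩
  choose a ha ha' using h
  refine ⟨fun j => ∏ k, linForm (a j k) ^ n k, fun j => ⟨?_, ?_, fun k hkj => ?_⟩⟩
  · refine IsHomogeneous.prod _ _ _ fun k _ => ?_
    simpa using (isHomogeneous_linForm (a j k)).pow (n k)
  · rw [map_prod]
    refine Finset.prod_ne_zero_iff.mpr fun k _ => ?_
    rw [map_pow, eval_linForm]
    exact pow_ne_zero _ (ha j k)
  · refine Ideal.mem_of_dvd _ (Finset.dvd_prod_of_mem _ (Finset.mem_univ k)) ?_
    exact Ideal.pow_mem_pow (mem_pointIdeal_of_isHomogeneous (isHomogeneous_linForm _)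
      (by rw [eval_linForm, ha' j k hkj])) _

theorem sum_quotHF_le_quotHF_iInf [CharZero K] {s : ℕ} {v : Fin s → Fin 3 → K}
    (hv : ∀ j, v j ≠ 0) (hdist : ∀ i j, i ≠ j → ∀ c : K, v i ≠ c • v j) (n : Fin s → ℕ) (d : ℕ) :
    ∑ j, quotHF (pointIdeal (v j) ^ n j) d
      ≤ quotHF (⨅ j, pointIdeal (v j) ^ n j) (∑ k, n k + d) := by
  obtain ⟨U, hU⟩ := exists_separating_forms hv hdist n
  set J : Fin s → Ideal (MvPolynomial (Fin 3) K) := fun j => pointIdeal (v j) ^ n j with hJ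
  set I := ⨅ j, J j
  have hle : ∀ j, idealPart (J j) d
      ≤ (idealPart I (∑ k, n k + d)).comap (mulForm (hU j).1 d) := fun j F hF => by
    refine (Submodule.mem_iInf J).mpr fun k => ?_
    rcases eq_or_ne k j with rfl | hkj
    · exact Ideal.mul_mem_left _ _ hF
    · exact Ideal.mul_mem_right _ _ ((hU j).2.2 k hkj)
  refine (finrank_pi_quot fun j => idealPart (J j) d).symm.trans_le ?_
  refine LinearMap.finrank_le_finrank_of_injective (f := LinearMap.lsum K _ K fun j =>
    Submodule.mapQ (idealPart (J j) d) (idealPart I (∑ k, n k + d)) (mulForm (hU j).1 d) (hle j)) ?_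
  rw [injective_iff_map_eq_zero]
  intro x hx
  choose G hG using fun j => Submodule.mkQ_surjective (idealPart (J j) d) (x j)
  obtain rfl : x = fun j => Submodule.mkQ _ (G j) := funext fun j => (hG j).symm
  have hsum : ∑ j, U j * (G j : MvPolynomial (Fin 3) K) ∈ I := by
    have h1 : Submodule.mkQ (idealPart I (∑ k, n k + d)) (∑ j, mulForm (hU j).1 d (G j)) = 0 := by
      rw [map_sum]
      simpa using hx
    have h2 := (Submodule.Quotient.mk_eq_zero _).mp h1
    have h3 : (((∑ j, mulForm (hU j).1 d (G j) :
        homogeneousSubmodule (Fin 3) K (∑ k, n k + d))) : MvPolynomial (Fin 3) K) ∈ I := h2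
    rw [Submodule.coe_sum] at h3
    exact h3
  funext k
  refine (Submodule.Quotient.mk_eq_zero (idealPart (J k) d)).mpr ?_
  refine mem_pow_of_mul_mem_pow (hv k) (hU k).2.1 (n k) (G k).2 ?_
  have h1 := (Submodule.mem_iInf J).mp hsum k
  rw [← Finset.add_sum_erase _ _ (Finset.mem_univ k)] at h1
  refine (Ideal.add_mem_iff_left _ (Ideal.sum_mem _ fun j hj => ?_)).mp h1
  exact Ideal.mul_mem_right _ _ ((hU j).2.2 k (Finset.ne_of_mem_erase hj).symm)

theorem quotHF_iInf_mono [CharZero K] {s : ℕ} {v : Fin s → Fin 3 → K} (hv : ∀ j, v j ≠ 0)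
    (n : Fin s → ℕ) : Monotone (quotHF (⨅ j, pointIdeal (v j) ^ n j)) := by
  obtain ⟨a, ha⟩ := exists_dotProduct_forall_ne_zero hv
  refine monotone_nat_of_le_succ fun d => ?_
  rw [add_comm]
  refine quotHF_le_of_mul_mem_iff (isHomogeneous_linForm a) fun F hF =>
    ⟨fun h => ?_, fun h => Ideal.mul_mem_left _ _ h⟩
  refine (Submodule.mem_iInf _).mpr fun j => ?_
  exact mem_pow_of_mul_mem_pow (hv j) (eval_linForm a (v j) ▸ ha j) _ hF
    ((Submodule.mem_iInf _).mp h j)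

/-- From the regularity index on, forms can be prescribed modulo the powers of the ideals
of the points simultaneously. -/
theorem exists_form_of_regIndex_le [CharZero K] {s : ℕ} {v : Fin s → Fin 3 → K}
    (hv : ∀ j, v j ≠ 0) (hdist : ∀ i j, i ≠ j → ∀ c : K, v i ≠ c • v j) (r : Fin s → ℕ) {i : ℕ}
    (hi : regIndex (⨅ j, pointIdeal (v j) ^ (r j + 1)) (∑ j, (r j + 2).choose 2) ≤ i)
    (F : Fin s → MvPolynomial (Fin 3) K) (hF : ∀ j, (F j).IsHomogeneous i) :
    ∃ G : MvPolynomial (Fin 3) K, G.IsHomogeneous i ∧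
      ∀ j, G - F j ∈ pointIdeal (v j) ^ (r j + 1) := by
  have hupper : ∀ d, ∑ j, quotHF (pointIdeal (v j) ^ (r j + 1)) d ≤ ∑ j, (r j + 2).choose 2 :=
    fun d => Finset.sum_le_sum fun j _ => quotHF_pointIdeal_pow_le (hv j) (r j) d
  have hne : {d | quotHF (⨅ j, pointIdeal (v j) ^ (r j + 1)) d
      = ∑ j, (r j + 2).choose 2}.Nonempty := by
    refine ⟨∑ k, (r k + 1) + ∑ k, r k, le_antisymm ((quotHF_iInf_le _ _).trans (hupper _)) ?_⟩
    refine le_trans (Finset.sum_le_sum fun j _ => ?_)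
      (sum_quotHF_le_quotHF_iInf hv hdist (fun j => r j + 1) (∑ k, r k))
    exact (quotHF_pointIdeal_pow_eq (hv j)
      (Finset.single_le_sum (fun k _ => Nat.zero_le (r k)) (Finset.mem_univ j))).ge
  refine exists_form_of_sum_quotHF_le ((hupper i).trans ?_) F hF
  exact (Nat.sInf_mem hne).ge.trans (quotHF_iInf_mono hv _ hi)

end FatPoints

section Exactness

variable {K : Type*} [Field K]

theorem pderiv_comm {σ : Type*} (k l : σ) (F : MvPolynomial σ K) :
    pderiv k (pderiv l F) = pderiv l (pderiv k F) := by
  rcases eq_or_ne k l with rfl | hkl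
  · rfl
  ext e
  simp only [coeff_pderiv, Finsupp.add_apply, Finsupp.single_eq_of_ne hkl,
    Finsupp.single_eq_of_ne hkl.symm, add_zero, add_right_comm e]
  ring

theorem pderiv_homogeneousComponent {σ : Type*} (k : σ) (n : ℕ) (F : MvPolynomial σ K) :
    pderiv k (homogeneousComponent (n + 1) F) = homogeneousComponent n (pderiv k F) := by
  ext e
  simp only [coeff_pderiv, coeff_homogeneousComponent, map_add, Finsupp.degree_single,
    add_left_inj, ite_mul, zero_mul]

theorem betaAmb_add (G G' : Fin 3 → MvPolynomial (Fin 3) K) :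
    betaAmb (G + G') = betaAmb G + betaAmb G' := by
  funext c
  fin_cases c <;> simp [betaAmb] <;> ring

theorem betaAmb_sub (G G' : Fin 3 → MvPolynomial (Fin 3) K) :
    betaAmb (G - G') = betaAmb G - betaAmb G' := by
  funext c
  fin_cases c <;> simp [betaAmb] <;> ring

theorem betaAmb_pderiv (F : MvPolynomial (Fin 3) K) : betaAmb (fun k => pderiv k F) = 0 := by
  funext c
  fin_cases c <;> simp [betaAmb, pderiv_comm]

theorem betaAmb_homogeneousComponent (n : ℕ) (G : Fin 3 → MvPolynomial (Fin 3) K) (c : Fin 3) :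
    betaAmb (fun k => homogeneousComponent (n + 1) (G k)) c
      = homogeneousComponent n (betaAmb G c) := by
  fin_cases c <;> simp [betaAmb, pderiv_homogeneousComponent]

theorem betaAmb_smul_sub_mem {I : Ideal (MvPolynomial (Fin 3) K)}
    {G : Fin 3 → MvPolynomial (Fin 3) K} (hG : ∀ k, G k ∈ I) (A : MvPolynomial (Fin 3) K)
    (c : Fin 3) : A * betaAmb G c - betaAmb (A • G) c ∈ I := by
  have h : ∀ k l k' l', A * (pderiv k (G l) - pderiv k' (G l'))
      - (pderiv k (A * G l) - pderiv k' (A * G l')) ∈ I := fun k l k' l' => by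
    rw [pderiv_mul, pderiv_mul]
    have := I.sub_mem (I.mul_mem_left (pderiv k' A) (hG l')) (I.mul_mem_left (pderiv k A) (hG l))
    convert this using 1
    ring
  fin_cases c <;> exact h _ _ _ _

theorem betaAmb_mem {I J : Ideal (MvPolynomial (Fin 3) K)}
    (hJ : ∀ F ∈ J, ∀ k, pderiv k F ∈ I) {G : Fin 3 → MvPolynomial (Fin 3) K}
    (hG : ∀ k, G k ∈ J) (c : Fin 3) : betaAmb G c ∈ I := by
  fin_cases c <;> exact I.sub_mem (hJ _ (hG _) _) (hJ _ (hG _) _)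

theorem pderiv_sub_pderiv_mem_of_betaAmb_mem {I : Ideal (MvPolynomial (Fin 3) K)}
    {G : Fin 3 → MvPolynomial (Fin 3) K} (h : ∀ c, betaAmb G c ∈ I) (k l : Fin 3) :
    pderiv l (G k) - pderiv k (G l) ∈ I := by
  have h01 : pderiv 0 (G 1) - pderiv 1 (G 0) ∈ I := h 0
  have h02 : pderiv 0 (G 2) - pderiv 2 (G 0) ∈ I := h 1
  have h12 : pderiv 1 (G 2) - pderiv 2 (G 1) ∈ I := h 2
  have hneg : ∀ {a b : MvPolynomial (Fin 3) K}, a - b ∈ I → b - a ∈ I := fun hab =>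
    by simpa only [neg_sub] using I.neg_mem hab
  have hself : ∀ a : MvPolynomial (Fin 3) K, a - a ∈ I := fun a => sub_self a ▸ I.zero_mem
  fin_cases k <;> fin_cases l
  exacts [hself _, hneg h01, hneg h02, h01, hself _, hneg h12, h02, h12, hself _]

/-- Modulo `I Ω²`, the relations of `Ω²` of the quotient by `I` are the exterior derivatives of
the elements of `I Ω¹`. -/
theorem mem_omega2Rel_iff {I : Ideal (MvPolynomial (Fin 3) K)}
    {H : Fin 3 → MvPolynomial (Fin 3) K} :
    H ∈ omega2Rel I ↔ ∃ G : Fin 3 → MvPolynomial (Fin 3) K,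
      (∀ k, G k ∈ I) ∧ ∀ c, H c - betaAmb G c ∈ I := by
  constructor
  · intro hH
    obtain ⟨H₁, h₁, H₂, h₂, rfl⟩ := Submodule.mem_sup.mp hH
    clear hH
    suffices h : ∃ G : Fin 3 → MvPolynomial (Fin 3) K,
        (∀ k, G k ∈ I) ∧ ∀ c, H₂ c - betaAmb G c ∈ I by
      obtain ⟨G, hG, hGH⟩ := h
      refine ⟨G, hG, fun c => ?_⟩
      rw [Pi.add_apply, add_sub_assoc]
      exact I.add_mem (h₁ c trivial) (hGH c)
    induction h₂ using Submodule.span_induction with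
    | mem x hx =>
      obtain ⟨F, hF, hx⟩ := hx
      have hmem : ∀ j k, (Pi.single j F : Fin 3 → MvPolynomial (Fin 3) K) k ∈ I := fun j k => by
        rcases eq_or_ne k j with rfl | hkj
        · rwa [Pi.single_eq_same]
        · rw [Pi.single_eq_of_ne hkj]
          exact I.zero_mem
      obtain ⟨j, hj⟩ : ∃ j, x = betaAmb (Pi.single j F) := by
        rcases hx with rfl | rfl | rfl
        · exact ⟨0, by simp [betaAmb]⟩
        · exact ⟨1, by simp [betaAmb]⟩
        · exact ⟨2, by simp [betaAmb]⟩
      exact ⟨Pi.single j F, hmem j, fun c => by rw [hj, sub_self]; exact I.zero_mem⟩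
    | zero => exact ⟨0, fun _ => I.zero_mem, fun c => by fin_cases c <;> simp [betaAmb]⟩
    | add x y _ _ hx hy =>
      obtain ⟨G, hG, hGx⟩ := hx
      obtain ⟨G', hG', hGy⟩ := hy
      refine ⟨G + G', fun k => I.add_mem (hG k) (hG' k), fun c => ?_⟩
      rw [betaAmb_add, Pi.add_apply, Pi.add_apply, add_sub_add_comm]
      exact I.add_mem (hGx c) (hGy c)
    | smul A x _ hx =>
      obtain ⟨G, hG, hGx⟩ := hx
      refine ⟨A • G, fun k => I.mul_mem_left A (hG k), fun c => ?_⟩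
      have := I.add_mem (I.mul_mem_left A (hGx c)) (betaAmb_smul_sub_mem hG A c)
      rwa [mul_sub, sub_add_sub_cancel] at this
  · rintro ⟨G, hG, hGH⟩
    rw [← sub_add_cancel H (betaAmb G)]
    refine Submodule.add_mem _ (Submodule.mem_sup_left fun c _ => hGH c)
      (Submodule.mem_sup_right ?_)
    have h : betaAmb G = ![-(pderiv 1 (G 0)), -(pderiv 2 (G 0)), 0]
        + (![pderiv 0 (G 1), 0, -(pderiv 2 (G 1))] + ![0, pderiv 0 (G 2), pderiv 1 (G 2)]) := by
      funext c
      fin_cases c <;> simp [betaAmb] <;> ring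
    rw [h]
    exact Submodule.add_mem _ (Submodule.subset_span ⟨G 0, hG 0, Or.inl rfl⟩)
      (Submodule.add_mem _ (Submodule.subset_span ⟨G 1, hG 1, Or.inr (Or.inl rfl)⟩)
        (Submodule.subset_span ⟨G 2, hG 2, Or.inr (Or.inr rfl)⟩))

section Graded

attribute [local instance] MvPolynomial.gradedAlgebra

theorem homogeneousComponent_mem_iInf_pointIdeal_pow {ι : Type*} (v : ι → Fin 3 → K) (n : ι → ℕ)
    {F : MvPolynomial (Fin 3) K} (hF : F ∈ ⨅ j, pointIdeal (v j) ^ n j) (d : ℕ) :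
    homogeneousComponent d F ∈ ⨅ j, pointIdeal (v j) ^ n j := by
  have hpow : ∀ (w : Fin 3 → K) (r : ℕ),
      (pointIdeal w ^ r).IsHomogeneous (homogeneousSubmodule (Fin 3) K) := fun w r => by
    induction r with
    | zero =>
      rw [pow_zero, Ideal.one_eq_top]
      exact Ideal.IsHomogeneous.top _
    | succ r ih =>
      rw [pow_succ]
      exact ih.mul (Ideal.homogeneous_span _ _ fun F hF => hF.1)
  exact homogeneousComponent_mem_of_mem (Ideal.IsHomogeneous.iInf fun j => hpow (v j) (n j)) hF d

end Graded

end Exactness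

/-- Let `W = m_1 P_1 + ⋯ + m_s P_s` be a fat point scheme in `ℙ²`
(char `K` = 0), with fattenings `W⁽¹⁾` and `W⁽²⁾`, and let
`t = max {r_{W⁽²⁾}, r_{W⁽¹⁾} + 1, r_W + 2}`. Then for all `i ≥ t` the sequence of
`K`-vector spaces
`0 → (I_{W⁽¹⁾}/I_{W⁽²⁾})_i → (I_W Ω¹/I_{W⁽¹⁾} Ω¹)_i → (Ω²_{S/K}/I_W Ω²)_i → (Ω²_{R_W/K})_i → 0`
is exact, where the maps are induced by exterior differentiation. Exactness is expressed
here in ambient terms: (a) injectivity of `α`; (b) `Im α = Ker β`; (c) `Im β = Ker γ`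
(`γ` being the canonical surjection, exactness at the last spot is automatic). -/
theorem exactness_kaehler_sequence_P2 {K : Type*} [Field K] [CharZero K]
    (s : ℕ) (hs : 0 < s)
    (v : Fin s → (Fin 3 → K))
    (hv0 : ∀ j, v j ≠ 0)
    (hdist : ∀ i j, i ≠ j → ∀ c : K, v i ≠ c • v j)
    (m : Fin s → ℕ) (hm : ∀ j, 1 ≤ m j)
    (IW0 IW1 IW2 : Ideal (MvPolynomial (Fin 3) K))
    (hIW0 : IW0 = ⨅ j, (pointIdeal (v j)) ^ (m j))
    (hIW1 : IW1 = ⨅ j, (pointIdeal (v j)) ^ (m j + 1))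
    (hIW2 : IW2 = ⨅ j, (pointIdeal (v j)) ^ (m j + 2))
    (t : ℕ)
    (ht : t = max (regIndex IW2 (∑ j : Fin s, (m j + 3).choose 2))
      (max (regIndex IW1 (∑ j : Fin s, (m j + 2).choose 2) + 1)
        (regIndex IW0 (∑ j : Fin s, (m j + 1).choose 2) + 2))) :
    ∀ i ≥ t,
      -- (a) injectivity of `α : (I_{W⁽¹⁾}/I_{W⁽²⁾})_i → (I_W Ω¹/I_{W⁽¹⁾} Ω¹)_i`, `F ↦ dF`
      (∀ F ∈ IW1, F.IsHomogeneous i → (∀ j : Fin 3, pderiv j F ∈ IW1) → F ∈ IW2) ∧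
      -- (b) `Im α = Ker β`
      (∀ G : Fin 3 → MvPolynomial (Fin 3) K,
        (∀ j, G j ∈ IW0 ∧ (G j).IsHomogeneous (i - 1)) →
        ((∀ c : Fin 3, betaAmb G c ∈ IW0) ↔
          ∃ F ∈ IW1, F.IsHomogeneous i ∧ ∀ j : Fin 3, G j - pderiv j F ∈ IW1)) ∧
      -- (c) `Im β = Ker γ`
      (∀ H : Fin 3 → MvPolynomial (Fin 3) K,
        (∀ c, (H c).IsHomogeneous (i - 2)) →
        (H ∈ omega2Rel IW0 ↔
          ∃ G : Fin 3 → MvPolynomial (Fin 3) K,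
            (∀ j, G j ∈ IW0 ∧ (G j).IsHomogeneous (i - 1)) ∧
            ∀ c : Fin 3, H c - betaAmb G c ∈ IW0)) := by
  subst hIW0 hIW1 hIW2 ht
  intro i hi
  have hi₂ : 2 ≤ i := by
    have := (le_max_right _ _).trans ((le_max_right _ _).trans hi)
    omega
  obtain ⟨n, rfl⟩ : ∃ n, i = n + 2 := ⟨i - 2, by omega⟩
  have hreg := (le_max_left _ _).trans hi
  have hpderiv : ∀ F ∈ ⨅ j, pointIdeal (v j) ^ (m j + 1), ∀ k,
      pderiv k F ∈ ⨅ j, pointIdeal (v j) ^ m j := fun F hF k =>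
    (Submodule.mem_iInf _).mpr fun j => pderiv_mem_pow ((Submodule.mem_iInf _).mp hF j) k
  refine ⟨fun F hF _ hdF => ?_, fun G hG => ⟨fun hβ => ?_, ?_⟩, fun H hH => ?_⟩
  · exact (Submodule.mem_iInf _).mpr fun j => mem_pow_succ_of_pderiv_mem (hv0 j) (m j).succ_ne_zero
      ((Submodule.mem_iInf _).mp hF j) fun k => (Submodule.mem_iInf _).mp (hdF k) j
  · have hlocal : ∀ j, ∃ F ∈ pointIdeal (v j) ^ (m j + 1), F.IsHomogeneous (n + 1 + 1) ∧
        ∀ l, G l - pderiv l F ∈ pointIdeal (v j) ^ (m j + 1) := fun j =>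
      exists_primitive_mod_pow (hv0 j) (Nat.one_le_iff_ne_zero.mp (hm j))
        (fun k => (Submodule.mem_iInf _).mp (hG k).1 j) (fun k => (hG k).2) fun k l =>
          (Submodule.mem_iInf _).mp (pderiv_sub_pderiv_mem_of_betaAmb_mem hβ k l) j
    choose F hF hFhom hFG using hlocal
    obtain ⟨E, hE, hEF⟩ := exists_form_of_regIndex_le hv0 hdist (fun j => m j + 1) hreg F hFhom
    refine ⟨E, (Submodule.mem_iInf _).mpr fun j => ?_, hE, fun k =>
      (Submodule.mem_iInf _).mpr fun j => ?_⟩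
    · rw [← sub_add_cancel E (F j)]
      exact Ideal.add_mem _ (Ideal.pow_le_pow_right (Nat.le_succ _) (hEF j)) (hF j)
    · have := Ideal.sub_mem _ (hFG j k) (pderiv_mem_pow (hEF j) k)
      rwa [map_sub, sub_sub, add_sub_cancel] at this
  · rintro ⟨F, -, -, hGF⟩ c
    have := betaAmb_mem hpderiv (G := G - fun k => pderiv k F) hGF c
    rwa [betaAmb_sub, betaAmb_pderiv, sub_zero] at this
  · rw [mem_omega2Rel_iff]
    refine ⟨fun ⟨G, hG, hGH⟩ => ⟨fun k => homogeneousComponent (n + 1) (G k), fun k =>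
      ⟨homogeneousComponent_mem_iInf_pointIdeal_pow v m (hG k) _,
        homogeneousComponent_isHomogeneous _ _⟩, fun c => ?_⟩,
      fun ⟨G, hG, hGH⟩ => ⟨G, fun k => (hG k).1, hGH⟩⟩
    have := homogeneousComponent_mem_iInf_pointIdeal_pow v m (hGH c) n
    rwa [map_sub, homogeneousComponent_eq_self (n := n) (hH c),
      ← betaAmb_homogeneousComponent] at this
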